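/- arXiv:1409.1972 — 2 statements merged into one kernel-verified Lean document; each statement's English description precedes it below -/
import Mathlib

section
/- Let $b > 0$ and let $\alpha^* : (-\tfrac{\pi^2}{8b^2}, \infty) \to \mathbb{R}$ be defined by $\alpha^*(\lambda) = \sqrt{2\lambda}\,\tanh(b\sqrt{2\lambda})$ for $\lambda \ge 0$ and $\alpha^*(\lambda) = -\sqrt{-2\lambda}\,\tan(b\sqrt{-2\lambda})$ for $\lambda < 0$. Define $V := (\alpha^*)^{-1} : \mathbb{R} \to (-\tfrac{\pi^2}{8b^2}, \infty)$, the inverse function of $\alpha^*$. Then $V$ is well-defined on all of $\mathbb{R}$, infinitely differentiable, strictly increasing, strictly convex, satisfies $V(0) = 0$, and its range is $(-\tfrac{\pi^2}{8b^2}, \infty)$. -/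
open scoped Real

/-- The smooth extension of `λ ↦ √(2λ) tanh(b√(2λ))` to `(-π²/(8b²), ∞)`, given for
negative arguments by `-√(-2λ) tan(b√(-2λ))`. -/
noncomputable def alphaStar (b lam : ℝ) : ℝ :=
  if 0 ≤ lam then Real.sqrt (2 * lam) * Real.tanh (b * Real.sqrt (2 * lam))
  else -(Real.sqrt (-(2 * lam)) * Real.tan (b * Real.sqrt (-(2 * lam))))

open scoped Nat

/-- The entire function `∑ zⁿ / (2n)!`, equal to `cosh √z` for `z ≥ 0` and to `cos √(-z)` for
`z ≤ 0`. -/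
noncomputable def coshSqrt (z : ℝ) : ℝ :=
  FormalMultilinearSeries.ofScalarsSum (E := ℝ) (fun n : ℕ => (((2 * n)! : ℕ) : ℝ)⁻¹) z

lemma coshSqrt_eq_tsum (z : ℝ) : coshSqrt z = ∑' n : ℕ, z ^ n / ((2 * n)! : ℕ) := by
  simp only [coshSqrt, FormalMultilinearSeries.ofScalars_sum_eq, smul_eq_mul, div_eq_inv_mul]

lemma coshSqrt_sq (x : ℝ) : coshSqrt (x ^ 2) = Real.cosh x := by
  rw [coshSqrt_eq_tsum, Real.cosh_eq_tsum]
  simp only [pow_mul]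

lemma coshSqrt_neg_sq (x : ℝ) : coshSqrt (-x ^ 2) = Real.cos x := by
  rw [coshSqrt_eq_tsum, Real.cos_eq_tsum]
  congr 1 with n
  rw [neg_pow, ← pow_mul]

lemma contDiff_coshSqrt : ContDiff ℝ (⊤ : ℕ∞) coshSqrt := by
  have hr : (FormalMultilinearSeries.ofScalars ℝ
      (fun n : ℕ => (((2 * n)! : ℕ) : ℝ)⁻¹)).radius = ⊤ := by
    refine FormalMultilinearSeries.radius_eq_top_of_summable_norm _ fun r => ?_
    have hs := (Real.hasSum_cosh (Real.sqrt r)).summable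
    refine hs.of_nonneg_of_le (fun n => by positivity) fun n => ?_
    rw [FormalMultilinearSeries.ofScalars_norm, pow_mul, Real.sq_sqrt r.coe_nonneg, div_eq_inv_mul]
    simp
  have h := (FormalMultilinearSeries.ofScalars ℝ
      (fun n : ℕ => (((2 * n)! : ℕ) : ℝ)⁻¹)).hasFPowerSeriesOnBall (by rw [hr]; simp)
  have h2 : AnalyticOnNhd ℝ coshSqrt (Metric.eball 0 ⊤) := by
    rw [← hr]
    exact h.analyticOnNhd
  refine contDiff_iff_contDiffAt.2 fun x => (h2 x ?_).contDiffAt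
  simp

lemma deriv_coshSqrt_sq (x : ℝ) : 2 * x * deriv coshSqrt (x ^ 2) = Real.sinh x := by
  have h1 : HasDerivAt coshSqrt (deriv coshSqrt (x ^ 2)) (x ^ 2) :=
    (contDiff_coshSqrt.differentiable (by simp) _).hasDerivAt
  have h2 := HasDerivAt.comp (h := fun x : ℝ => x ^ 2) x h1 (hasDerivAt_pow 2 x)
  have h3 : coshSqrt ∘ (fun x => x ^ 2) = Real.cosh := funext coshSqrt_sq
  rw [h3] at h2
  have := h2.unique (Real.hasDerivAt_cosh x)
  rw [← this]; push_cast; ring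

lemma deriv_coshSqrt_neg_sq (x : ℝ) : 2 * x * deriv coshSqrt (-x ^ 2) = Real.sin x := by
  have h1 : HasDerivAt coshSqrt (deriv coshSqrt (-x ^ 2)) (-x ^ 2) :=
    (contDiff_coshSqrt.differentiable (by simp) _).hasDerivAt
  have h2 := h1.comp x (hasDerivAt_pow 2 x).neg
  have h3 : coshSqrt ∘ (-fun x => x ^ 2) = Real.cos := funext coshSqrt_neg_sq
  rw [h3] at h2
  have := h2.unique (Real.hasDerivAt_cos x)
  rw [← neg_inj, ← this]; push_cast; ring

/-- The analytic function equal to `√z tanh √z` for `z ≥ 0` and to `-√(-z) tan √(-z)` for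
`-π²/4 < z ≤ 0`. -/
noncomputable def sqrtMulTanhSqrt (z : ℝ) : ℝ := 2 * z * deriv coshSqrt z / coshSqrt z

lemma sqrtMulTanhSqrt_sq (x : ℝ) : sqrtMulTanhSqrt (x ^ 2) = x * Real.tanh x := by
  rw [sqrtMulTanhSqrt, coshSqrt_sq, Real.tanh_eq_sinh_div_cosh, ← deriv_coshSqrt_sq]; ring

lemma sqrtMulTanhSqrt_neg_sq (x : ℝ) : sqrtMulTanhSqrt (-x ^ 2) = -(x * Real.tan x) := by
  rw [sqrtMulTanhSqrt, coshSqrt_neg_sq, Real.tan_eq_sin_div_cos, ← deriv_coshSqrt_neg_sq]; ring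

lemma exists_eq_neg_sq_of_mem {z : ℝ} (hz : -(π ^ 2 / 4) < z) (hz0 : z < 0) :
    ∃ x, 0 < x ∧ x < π / 2 ∧ z = -x ^ 2 := by
  refine ⟨√(-z), Real.sqrt_pos.2 (by linarith), ?_, ?_⟩
  · rw [Real.sqrt_lt' (by positivity)]; linarith
  · rw [Real.sq_sqrt (by linarith)]; ring

lemma exists_eq_sq_of_pos {z : ℝ} (hz : 0 < z) : ∃ x, 0 < x ∧ z = x ^ 2 :=
  ⟨√z, Real.sqrt_pos.2 hz, (Real.sq_sqrt hz.le).symm⟩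

lemma coshSqrt_pos {z : ℝ} (hz : -(π ^ 2 / 4) < z) : 0 < coshSqrt z := by
  rcases lt_or_ge z 0 with h | h
  · obtain ⟨x, h0, h1, rfl⟩ := exists_eq_neg_sq_of_mem hz h
    rw [coshSqrt_neg_sq]
    exact Real.cos_pos_of_mem_Ioo ⟨by linarith, h1⟩
  · rw [← Real.sq_sqrt h, coshSqrt_sq]
    exact Real.cosh_pos _

lemma contDiffAt_sqrtMulTanhSqrt {z : ℝ} (hz : -(π ^ 2 / 4) < z) :
    ContDiffAt ℝ (⊤ : ℕ∞) sqrtMulTanhSqrt z := by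
  have h : ContDiff ℝ (⊤ : ℕ∞) (deriv coshSqrt) :=
    (contDiff_infty_iff_deriv.1 contDiff_coshSqrt).2
  exact ((contDiff_const.mul contDiff_id).mul h).contDiffAt.div contDiff_coshSqrt.contDiffAt
    (coshSqrt_pos hz).ne'

lemma hasDerivAt_sqrtMulTanhSqrt {z : ℝ} (hz : -(π ^ 2 / 4) < z) :
    HasDerivAt sqrtMulTanhSqrt (deriv sqrtMulTanhSqrt z) z :=
  ((contDiffAt_sqrtMulTanhSqrt hz).differentiableAt (by simp)).hasDerivAt

lemma strictAntiOn_sinh_add_div :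
    StrictAntiOn (fun t : ℝ => (Real.sinh t + t) / (t * (1 + Real.cosh t))) (Set.Ioi 0) := by
  have hd : ∀ t ∈ Set.Ioi (0 : ℝ), HasDerivAt
      (fun t : ℝ => (Real.sinh t + t) / (t * (1 + Real.cosh t)))
      (((1 + Real.cosh t) * (t - Real.sinh t) - Real.sinh t * t ^ 2) /
        (t * (1 + Real.cosh t)) ^ 2) t := by
    intro t ht
    have ht : 0 < t := ht
    have hc := Real.cosh_pos t
    convert! ((Real.hasDerivAt_sinh t).add (hasDerivAt_id t)).div
      ((hasDerivAt_id t).mul ((Real.hasDerivAt_cosh t).const_add 1)) ?_ using 2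
    · simp only [id, Pi.add_apply, Pi.mul_apply]
      linear_combination (-t) * Real.cosh_sq t
    · simp only [id, Pi.mul_apply]
      positivity
  refine strictAntiOn_of_deriv_neg (convex_Ioi 0)
    (fun t ht => (hd t ht).continuousAt.continuousWithinAt) fun t ht => ?_
  rw [interior_Ioi] at ht
  rw [(hd t ht).deriv]
  have ht : 0 < t := ht
  have hc := Real.cosh_pos t
  have hs := Real.self_lt_sinh_iff.2 ht
  have h1 := mul_pos (add_pos one_pos hc) (sub_pos.2 hs)
  have h2 : 0 < Real.sinh t * t ^ 2 := by have := ht.trans hs; positivity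
  exact div_neg_of_neg_of_pos (by linarith) (by positivity)

lemma strictMonoOn_sin_add_div :
    StrictMonoOn (fun t : ℝ => (Real.sin t + t) / (t * (1 + Real.cos t))) (Set.Ioo 0 π) := by
  have hc : ∀ t ∈ Set.Ioo 0 π, 0 < 1 + Real.cos t := fun t ht => by
    have := Real.cos_lt_cos_of_nonneg_of_le_pi ht.1.le le_rfl ht.2
    rw [Real.cos_pi] at this
    linarith
  have hd : ∀ t ∈ Set.Ioo 0 π, HasDerivAt
      (fun t : ℝ => (Real.sin t + t) / (t * (1 + Real.cos t)))
      (((1 + Real.cos t) * (t - Real.sin t) + Real.sin t * t ^ 2) /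
        (t * (1 + Real.cos t)) ^ 2) t := by
    intro t ht
    have hc := hc t ht
    have h0 := ht.1
    convert! ((Real.hasDerivAt_sin t).add (hasDerivAt_id t)).div
      ((hasDerivAt_id t).mul ((Real.hasDerivAt_cos t).const_add 1)) ?_ using 2
    · simp only [id, Pi.add_apply, Pi.mul_apply]
      linear_combination (-t) * Real.sin_sq_add_cos_sq t
    · simp only [id, Pi.mul_apply]
      positivity
  refine strictMonoOn_of_deriv_pos (convex_Ioo 0 π)
    (fun t ht => (hd t ht).continuousAt.continuousWithinAt) fun t ht => ?_
  rw [interior_Ioo] at ht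
  rw [(hd t ht).deriv]
  have hc := hc t ht
  have h0 := ht.1
  have hs := sub_pos.2 (Real.sin_lt h0)
  have hs' := Real.sin_pos_of_mem_Ioo ht
  positivity

lemma deriv_sqrtMulTanhSqrt_sq {x : ℝ} (hx : 0 < x) : deriv sqrtMulTanhSqrt (x ^ 2) =
    (Real.sinh (2 * x) + 2 * x) / (2 * x * (1 + Real.cosh (2 * x))) := by
  have h1 := (hasDerivAt_sqrtMulTanhSqrt (z := x ^ 2) (by
    have := Real.pi_pos; linarith [pow_pos hx 2, pow_pos this 2])).comp x (hasDerivAt_pow 2 x)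
  have hc := Real.cosh_pos x
  have h3 : sqrtMulTanhSqrt ∘ (fun x => x ^ 2) = fun x => x * (Real.sinh x / Real.cosh x) :=
    funext fun y => by
      rw [Function.comp_apply, sqrtMulTanhSqrt_sq, Real.tanh_eq_sinh_div_cosh]
  rw [h3] at h1
  have h4 := h1.unique ((hasDerivAt_id x).mul
    ((Real.hasDerivAt_sinh x).div (Real.hasDerivAt_cosh x) hc.ne'))
  have h5 : deriv sqrtMulTanhSqrt (x ^ 2) =
      (1 * (Real.sinh x / Real.cosh x) + x * ((Real.cosh x * Real.cosh x -
        Real.sinh x * Real.sinh x) / Real.cosh x ^ 2)) / (2 * x) := by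
    rw [eq_div_iff (by positivity)]
    simpa using! h4
  rw [h5, ← sq, ← sq, Real.cosh_sq_sub_sinh_sq, Real.sinh_two_mul, Real.cosh_two_mul,
    Real.sinh_sq, show 1 + (Real.cosh x ^ 2 + (Real.cosh x ^ 2 - 1)) = 2 * Real.cosh x ^ 2 by ring]
  field_simp

lemma deriv_sqrtMulTanhSqrt_neg_sq {x : ℝ} (hx : 0 < x) (hx' : x < π / 2) :
    deriv sqrtMulTanhSqrt (-x ^ 2) =
    (Real.sin (2 * x) + 2 * x) / (2 * x * (1 + Real.cos (2 * x))) := by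
  have h1 := (hasDerivAt_sqrtMulTanhSqrt (z := -x ^ 2) (by nlinarith)).comp x
    (hasDerivAt_pow 2 x).neg
  have hc := Real.cos_pos_of_mem_Ioo ⟨by linarith, hx'⟩
  have h3 : sqrtMulTanhSqrt ∘ (-fun x => x ^ 2) = -fun x => x * (Real.sin x / Real.cos x) :=
    funext fun y => by
      rw [Function.comp_apply, Pi.neg_apply, sqrtMulTanhSqrt_neg_sq, Real.tan_eq_sin_div_cos]; rfl
  rw [h3] at h1
  have h4 := h1.unique ((hasDerivAt_id x).mul
    ((Real.hasDerivAt_sin x).div (Real.hasDerivAt_cos x) hc.ne')).neg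
  have h5 : deriv sqrtMulTanhSqrt (-x ^ 2) =
      (1 * (Real.sin x / Real.cos x) + x * ((Real.cos x * Real.cos x -
        Real.sin x * -Real.sin x) / Real.cos x ^ 2)) / (2 * x) := by
    rw [eq_div_iff (by positivity)]
    rw [← neg_inj, ← mul_neg]
    simpa [-mul_neg, -neg_inj, -neg_add_rev] using! h4
  rw [h5, show Real.cos x * Real.cos x - Real.sin x * -Real.sin x = 1 by
    linear_combination Real.sin_sq_add_cos_sq x, Real.sin_two_mul, Real.cos_two_mul,
    show 1 + (2 * Real.cos x ^ 2 - 1) = 2 * Real.cos x ^ 2 by ring]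
  field_simp

lemma strictAntiOn_Ioi_of_Ioo_of_Ioi {f : ℝ → ℝ} {a c : ℝ} (h₁ : StrictAntiOn f (Set.Ioo a c))
    (h₂ : StrictAntiOn f (Set.Ioi c)) (hc : ContinuousAt f c) : StrictAntiOn f (Set.Ioi a) := by
  have hl : ∀ x ∈ Set.Ioo a c, f c < f x := fun x hx => by
    obtain ⟨m, hxm, hmc⟩ := exists_between hx.2
    refine lt_of_le_of_lt
      (le_of_tendsto (x := nhdsWithin c (Set.Iio c)) (hc.tendsto.mono_left nhdsWithin_le_nhds) ?_)
      (h₁ hx ⟨hx.1.trans hxm, hmc⟩ hxm)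
    filter_upwards [Ioo_mem_nhdsLT hmc] with y hy
    exact (h₁ ⟨hx.1.trans hxm, hmc⟩ ⟨hx.1.trans (hxm.trans hy.1), hy.2⟩ hy.1).le
  have hr : ∀ x ∈ Set.Ioi c, f x < f c := fun x hx => by
    obtain ⟨m, hcm, hmx⟩ := exists_between (Set.mem_Ioi.1 hx)
    refine (h₂ hcm hx hmx).trans_le
      (ge_of_tendsto (x := nhdsWithin c (Set.Ioi c)) (hc.tendsto.mono_left nhdsWithin_le_nhds) ?_)
    filter_upwards [Ioo_mem_nhdsGT hcm] with y hy
    exact (h₂ hy.1 hcm hy.2).le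
  intro x hx y hy hxy
  rcases lt_trichotomy x c with hxc | rfl | hxc
  · rcases lt_trichotomy y c with hyc | rfl | hyc
    · exact h₁ ⟨hx, hxc⟩ ⟨hy, hyc⟩ hxy
    · exact hl x ⟨hx, hxc⟩
    · exact (hr y hyc).trans (hl x ⟨hx, hxc⟩)
  · exact hr y hxy
  · exact h₂ hxc (hxc.trans hxy) hxy

lemma strictAntiOn_deriv_sqrtMulTanhSqrt :
    StrictAntiOn (deriv sqrtMulTanhSqrt) (Set.Ioi (-(π ^ 2 / 4))) := by
  refine strictAntiOn_Ioi_of_Ioo_of_Ioi (c := 0) ?_ ?_ ?_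
  · intro z hz w hw hzw
    obtain ⟨x, hx0, hx, rfl⟩ := exists_eq_neg_sq_of_mem hz.1 hz.2
    obtain ⟨y, hy0, hy, rfl⟩ := exists_eq_neg_sq_of_mem hw.1 hw.2
    rw [deriv_sqrtMulTanhSqrt_neg_sq hx0 hx, deriv_sqrtMulTanhSqrt_neg_sq hy0 hy]
    have := lt_of_pow_lt_pow_left₀ 2 hx0.le (neg_lt_neg_iff.1 hzw)
    exact strictMonoOn_sin_add_div ⟨by linarith, by linarith⟩ ⟨by linarith, by linarith⟩
      (by linarith)
  · intro z hz w hw hzw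
    obtain ⟨x, hx, rfl⟩ := exists_eq_sq_of_pos hz
    obtain ⟨y, hy, rfl⟩ := exists_eq_sq_of_pos hw
    rw [deriv_sqrtMulTanhSqrt_sq hx, deriv_sqrtMulTanhSqrt_sq hy]
    have := lt_of_pow_lt_pow_left₀ 2 hy.le hzw
    exact strictAntiOn_sinh_add_div (Set.mem_Ioi.2 (by linarith)) (Set.mem_Ioi.2 (by linarith))
      (by linarith)
  · have h0 : -(π ^ 2 / 4) < 0 := by have := Real.pi_pos; simp; positivity
    exact ((contDiffAt_sqrtMulTanhSqrt h0).continuousAt_fderiv (by simp)).clm_apply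
      continuousAt_const

lemma deriv_sqrtMulTanhSqrt_pos {z : ℝ} (hz : -(π ^ 2 / 4) < z) :
    0 < deriv sqrtMulTanhSqrt z := by
  have hpos : ∀ z, 0 < z → 0 < deriv sqrtMulTanhSqrt z := fun z hz => by
    obtain ⟨x, hx, rfl⟩ := exists_eq_sq_of_pos hz
    rw [deriv_sqrtMulTanhSqrt_sq hx]
    have := Real.sinh_pos_iff.2 (by linarith : 0 < 2 * x)
    have := Real.cosh_pos (2 * x)
    positivity
  refine (hpos (|z| + 1) (by positivity)).trans
    (strictAntiOn_deriv_sqrtMulTanhSqrt hz ?_ (by linarith [le_abs_self z]))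
  exact Set.mem_Ioi.2 (by linarith [le_abs_self z])

lemma strictMonoOn_sqrtMulTanhSqrt : StrictMonoOn sqrtMulTanhSqrt (Set.Ioi (-(π ^ 2 / 4))) :=
  strictMonoOn_of_deriv_pos (convex_Ioi _)
    (fun _ hz => (hasDerivAt_sqrtMulTanhSqrt hz).continuousAt.continuousWithinAt)
    fun _ hz => deriv_sqrtMulTanhSqrt_pos (by rwa [interior_Ioi] at hz)

lemma surjOn_sqrtMulTanhSqrt :
    Set.SurjOn sqrtMulTanhSqrt (Set.Ioi (-(π ^ 2 / 4))) Set.univ := by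
  intro α _
  have ha := abs_nonneg α
  have hpi := Real.pi_gt_three
  set s := 1 + 2 * |α| with hs
  have hy : π / 4 ≤ Real.arctan s := by
    rw [← Real.arctan_one]; exact Real.arctan_strictMono.monotone (by linarith)
  have hy' := Real.arctan_lt_pi_div_two s
  have hl : -(π ^ 2 / 4) < -Real.arctan s ^ 2 := by nlinarith
  have hr : -(π ^ 2 / 4) < s ^ 2 := by nlinarith
  refine isPreconnected_Ioi.intermediate_value hl hr
    (fun _ hz => (hasDerivAt_sqrtMulTanhSqrt hz).continuousAt.continuousWithinAt) ⟨?_, ?_⟩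
  · rw [sqrtMulTanhSqrt_neg_sq, Real.tan_arctan]
    nlinarith [neg_abs_le α]
  · rw [sqrtMulTanhSqrt_sq, Real.tanh_eq_sinh_div_cosh]
    have hsinh := Real.self_lt_sinh_iff.2 (by linarith : 0 < s)
    have hcosh := Real.cosh_pos s
    have : 1 / 2 ≤ Real.sinh s / Real.cosh s := by
      rw [le_div_iff₀ hcosh]
      nlinarith [Real.cosh_sq s]
    nlinarith [le_abs_self α]

lemma alphaStar_eq {b : ℝ} (hb : 0 < b) (lam : ℝ) :
    alphaStar b lam = sqrtMulTanhSqrt (2 * b ^ 2 * lam) / b := by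
  rw [eq_div_iff hb.ne', alphaStar]
  split_ifs with h
  · rw [show 2 * b ^ 2 * lam = (b * √(2 * lam)) ^ 2 by
      rw [mul_pow, Real.sq_sqrt (by linarith)]; ring, sqrtMulTanhSqrt_sq]
    ring
  · rw [show 2 * b ^ 2 * lam = -(b * √(-(2 * lam))) ^ 2 by
      rw [mul_pow, Real.sq_sqrt (by linarith)]; ring, sqrtMulTanhSqrt_neg_sq]
    ring

/-- The inverse of a function on an open half-line which is smooth, has positive strictly
decreasing derivative and is onto `ℝ`, is smooth, strictly increasing and strictly convex. -/
lemma smooth_strictMono_strictConvexOn_of_inverse {f g : ℝ → ℝ} {a : ℝ}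
    (hf : ∀ z ∈ Set.Ioi a, ContDiffAt ℝ (⊤ : ℕ∞) f z)
    (hpos : ∀ z ∈ Set.Ioi a, 0 < deriv f z) (hanti : StrictAntiOn (deriv f) (Set.Ioi a))
    (hg : ∀ y, g y ∈ Set.Ioi a) (hfg : ∀ y, f (g y) = y) :
    ContDiff ℝ (⊤ : ℕ∞) g ∧ StrictMono g ∧ StrictConvexOn ℝ Set.univ g ∧
      Set.range g = Set.Ioi a := by
  have hd : ∀ z ∈ Set.Ioi a, HasDerivAt f (deriv f z) z := fun z hz =>
    ((hf z hz).differentiableAt (by simp)).hasDerivAt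
  have hcf : ContinuousOn f (Set.Ioi a) := fun z hz => (hd z hz).continuousAt.continuousWithinAt
  have hmf : StrictMonoOn f (Set.Ioi a) := strictMonoOn_of_deriv_pos (convex_Ioi _) hcf
    fun z hz => hpos z (by rwa [interior_Ioi] at hz)
  have hgf : ∀ z ∈ Set.Ioi a, g (f z) = z := fun z hz => hmf.injOn (hg _) hz (hfg _)
  have hmg : StrictMono g := fun x y hxy => by
    rw [← hmf.lt_iff_lt (hg x) (hg y), hfg, hfg]
    exact hxy
  have hrange : Set.range g = Set.Ioi a :=
    Set.Subset.antisymm (Set.range_subset_iff.2 hg) fun z hz => ⟨f z, hgf z hz⟩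
  have hcg : Continuous g := continuous_iff_continuousAt.2 fun y =>
    continuousAt_of_monotoneOn_of_image_mem_nhds (hmg.monotone.monotoneOn Set.univ)
      Filter.univ_mem (by rw [Set.image_univ, hrange]; exact Ioi_mem_nhds (hg y))
  let e : OpenPartialHomeomorph ℝ ℝ :=
    { toFun := f
      invFun := g
      source := Set.Ioi a
      target := Set.univ
      map_source' := fun _ _ => Set.mem_univ _
      map_target' := fun y _ => hg y
      left_inv' := hgf
      right_inv' := fun y _ => hfg y
      open_source := isOpen_Ioi
      open_target := isOpen_univ
      continuousOn_toFun := hcf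
      continuousOn_invFun := hcg.continuousOn }
  refine ⟨contDiff_iff_contDiffAt.2 fun y => e.contDiffAt_symm_deriv (hpos _ (hg y)).ne'
    (Set.mem_univ y) (hd _ (hg y)) (hf _ (hg y)), hmg,
    StrictMono.strictConvexOn_univ_of_deriv hcg fun x y hxy => ?_, hrange⟩
  have hdg : ∀ y, deriv g y = (deriv f (g y))⁻¹ := fun y =>
    ((hd _ (hg y)).of_local_left_inverse hcg.continuousAt (hpos _ (hg y)).ne'
      (Filter.Eventually.of_forall hfg)).deriv
  rw [hdg, hdg]
  exact inv_strictAnti₀ (hpos _ (hg y)) (hanti (hg x) (hg y) (hmg hxy))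

/-- For `b > 0`, the inverse `V = (α*)⁻¹` of the extended function `α*` is a
well-defined function on all of `ℝ`, is infinitely differentiable, strictly increasing,
strictly convex, satisfies `V(0) = 0`, and has range `(-π²/(8b²), ∞)`. -/
theorem V_inverse_of_alphaStar_smooth_strictMono_strictConvex (b : ℝ) (hb : 0 < b) :
    ∃ V : ℝ → ℝ,
      (∀ α : ℝ, V α ∈ Set.Ioi (-(π ^ 2 / (8 * b ^ 2))) ∧ alphaStar b (V α) = α ∧
        ∀ lam ∈ Set.Ioi (-(π ^ 2 / (8 * b ^ 2))), alphaStar b lam = α → lam = V α) ∧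
      ContDiff ℝ (⊤ : ℕ∞) V ∧
      StrictMono V ∧
      StrictConvexOn ℝ Set.univ V ∧
      V 0 = 0 ∧
      Set.range V = Set.Ioi (-(π ^ 2 / (8 * b ^ 2))) := by
  have hscale : ∀ lam, lam ∈ Set.Ioi (-(π ^ 2 / (8 * b ^ 2))) ↔
      2 * b ^ 2 * lam ∈ Set.Ioi (-(π ^ 2 / 4)) := fun lam => by
    rw [Set.mem_Ioi, Set.mem_Ioi, ← mul_lt_mul_iff_right₀ (by positivity : 0 < 2 * b ^ 2),
      show 2 * b ^ 2 * -(π ^ 2 / (8 * b ^ 2)) = -(π ^ 2 / 4) by field_simp; norm_num]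
  have hinj : Set.InjOn (alphaStar b) (Set.Ioi (-(π ^ 2 / (8 * b ^ 2)))) := by
    intro x hx y hy hxy
    rw [alphaStar_eq hb, alphaStar_eq hb, div_left_inj' hb.ne'] at hxy
    exact mul_left_cancel₀ (by positivity) (strictMonoOn_sqrtMulTanhSqrt.injOn
      ((hscale x).1 hx) ((hscale y).1 hy) hxy)
  have hsurj : ∀ α, ∃ lam ∈ Set.Ioi (-(π ^ 2 / (8 * b ^ 2))), alphaStar b lam = α := by
    intro α
    obtain ⟨z, hz, hzα⟩ := surjOn_sqrtMulTanhSqrt (Set.mem_univ (α * b))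
    have hz' : 2 * b ^ 2 * (z / (2 * b ^ 2)) = z := by field_simp
    refine ⟨z / (2 * b ^ 2), (hscale _).2 (by rwa [hz']), ?_⟩
    rw [alphaStar_eq hb, hz', hzα, mul_div_cancel_right₀ _ hb.ne']
  have hd : ∀ lam ∈ Set.Ioi (-(π ^ 2 / (8 * b ^ 2))),
      deriv (alphaStar b) lam = 2 * b * deriv sqrtMulTanhSqrt (2 * b ^ 2 * lam) := by
    intro lam hlam
    have h := ((hasDerivAt_sqrtMulTanhSqrt ((hscale lam).1 hlam)).comp lam
      ((hasDerivAt_id lam).const_mul (2 * b ^ 2))).div_const b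
    rw [show alphaStar b = _ from funext (alphaStar_eq hb)]
    refine h.deriv.trans ?_
    field_simp
  choose V hV hαV using hsurj
  obtain ⟨h1, h2, h3, h4⟩ := smooth_strictMono_strictConvexOn_of_inverse (f := alphaStar b)
    (fun lam hlam => by
      rw [show alphaStar b = _ from funext (alphaStar_eq hb)]
      exact (ContDiffAt.comp lam (contDiffAt_sqrtMulTanhSqrt ((hscale lam).1 hlam))
        (contDiffAt_const.mul contDiffAt_id)).div_const b)
    (fun lam hlam => by
      rw [hd lam hlam]
      have := deriv_sqrtMulTanhSqrt_pos ((hscale lam).1 hlam)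
      positivity)
    (fun x hx y hy hxy => by
      rw [hd x hx, hd y hy]
      have := strictAntiOn_deriv_sqrtMulTanhSqrt ((hscale x).1 hx) ((hscale y).1 hy) (by gcongr)
      gcongr)
    hV hαV
  refine ⟨V, fun α => ⟨hV α, hαV α, fun lam hlam h => hinj hlam (hV α) (h.trans (hαV α).symm)⟩,
    h1, h2, h3, hinj (hV 0) ?_ ?_, h4⟩
  · rw [hscale, mul_zero]
    have := Real.pi_pos
    simp only [Set.mem_Ioi, Left.neg_neg_iff]
    positivity
  · rw [hαV]
    simp [alphaStar]
end

section
/- Let $b > 0$, let $\alpha^*$ be the smooth extension to $(-\tfrac{\pi^2}{8b^2},\infty)$ of $\lambda \mapsto \sqrt{2\lambda}\,\tanh(b\sqrt{2\lambda})$, let $V := (\alpha^*)^{-1}$, and define $V^*(x) := \sup_{\alpha \in \mathbb{R}} (\alpha x - V(\alpha))$ for $x \ge 0$. Then $V^*$ is continuous on $[0,\infty)$, continuously differentiable on $(0,\infty)$, and for every $x > 0$ its derivative is $(V^*)'(x) = \alpha^*(\lambda^*(x))$, where $\lambda^*(x)$ is the unique solution in $(-\tfrac{\pi^2}{8b^2},\infty)$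 of $(\alpha^*)'(\lambda) = 1/x$. -/
open scoped Real

theorem hasDerivAt_tanh (x : ℝ) : HasDerivAt Real.tanh (1 / Real.cosh x ^ 2) x := by
  have h := (Real.hasDerivAt_sinh x).div (Real.hasDerivAt_cosh x) (Real.cosh_pos x).ne'
  have e : Real.tanh = Real.sinh / Real.cosh := by
    funext y
    exact Real.tanh_eq_sinh_div_cosh y
  rw [e]
  have hnum : 1 = Real.cosh x * Real.cosh x - Real.sinh x * Real.sinh x := by
    rw [← Real.cosh_sq_sub_sinh_sq x]
    ring
  rwa [hnum]

theorem hasDerivAt_sqrt_two_mul {x : ℝ} (hx : 0 < x) :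
    HasDerivAt (fun y : ℝ => Real.sqrt (2 * y)) (2 / (2 * Real.sqrt (2 * x))) x := by
  have h := ((hasDerivAt_id x).const_mul 2).sqrt (by simp; exact hx.ne')
  simpa using h

theorem alphaStar_hasDerivAt_of_pos {b x : ℝ} (hb : 0 < b) (hx : 0 < x) :
    ∃ d, 0 < d ∧ HasDerivAt (alphaStar b) d x := by
  have hs : 0 < Real.sqrt (2 * x) := Real.sqrt_pos.2 (by linarith)
  have htanh : 0 < Real.tanh (b * Real.sqrt (2 * x)) := by
    rw [Real.tanh_eq_sinh_div_cosh]
    exact div_pos (Real.sinh_pos_iff.2 (mul_pos hb hs)) (Real.cosh_pos _)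
  have hsqrt := hasDerivAt_sqrt_two_mul hx
  have h := hsqrt.mul ((hasDerivAt_tanh _).comp x (hsqrt.const_mul b))
  refine ⟨_, ?_, h.congr_of_eventuallyEq ?_⟩
  · have := Real.cosh_pos (b * Real.sqrt (2 * x))
    simp only [Function.comp_apply]
    positivity
  · filter_upwards [lt_mem_nhds hx] with y hy
    simp [alphaStar, hy.le]

theorem alphaStar_hasDerivAt_of_neg {b x : ℝ} (hb : 0 < b) (hx : x < 0)
    (hxb : -(π ^ 2 / (8 * b ^ 2)) < x) :
    ∃ d, 0 < d ∧ HasDerivAt (alphaStar b) d x := by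
  have hs : 0 < Real.sqrt (2 * -x) := Real.sqrt_pos.2 (by linarith)
  have hlt : b * Real.sqrt (2 * -x) < π / 2 := by
    refine lt_of_pow_lt_pow_left₀ 2 (by positivity) ?_
    rw [mul_pow, Real.sq_sqrt (by linarith)]
    have h : -x < π ^ 2 / (8 * b ^ 2) := by linarith
    rw [lt_div_iff₀ (by positivity)] at h
    nlinarith
  have hpos : 0 < b * Real.sqrt (2 * -x) := mul_pos hb hs
  have htan := Real.tan_pos_of_pos_of_lt_pi_div_two hpos hlt
  have hcos : 0 < Real.cos (b * Real.sqrt (2 * -x)) :=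
    Real.cos_pos_of_mem_Ioo ⟨by linarith, hlt⟩
  have hsqrt := hasDerivAt_sqrt_two_mul (neg_pos.2 hx)
  have h := hsqrt.mul ((Real.hasDerivAt_tan hcos.ne').comp (-x) (hsqrt.const_mul b))
  have h' := (h.comp x (hasDerivAt_neg x)).neg
  refine ⟨_, ?_, h'.congr_of_eventuallyEq ?_⟩
  · rw [mul_neg_one, neg_neg]
    simp only [Function.comp_apply]
    positivity
  · filter_upwards [gt_mem_nhds hx] with y hy
    simp only [alphaStar, if_neg (not_le.2 hy), Pi.neg_apply, Pi.mul_apply, Function.comp_apply,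
      mul_neg]

/-- If `g` vanishes at `0` and has derivative `b` there, then `g s / s` extends continuously
by `b`. -/
theorem exists_continuousAt_factor {g : ℝ → ℝ} {b : ℝ} (hg : HasDerivAt g b 0) (h0 : g 0 = 0) :
    ∃ k : ℝ → ℝ, ContinuousAt k 0 ∧ k 0 = b ∧ ∀ s, g s = s * k s := by
  refine ⟨dslope g 0, continuousAt_dslope_same.2 hg.differentiableAt, ?_, fun s => ?_⟩
  · rw [dslope_same, hg.deriv]
  · simpa [h0] using (sub_smul_dslope g 0 s).symm

theorem alphaStar_hasDerivAt_zero (b : ℝ) : HasDerivAt (alphaStar b) (2 * b) 0 := by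
  have hmul : HasDerivAt (fun s : ℝ => b * s) b 0 := by
    simpa using (hasDerivAt_id (0 : ℝ)).const_mul b
  have h1 : HasDerivAt (fun s => Real.tanh (b * s)) b 0 := by
    simpa [Function.comp_def] using (hasDerivAt_tanh (b * 0)).comp 0 hmul
  have h2 : HasDerivAt (fun s => Real.tan (b * s)) b 0 := by
    simpa [Function.comp_def] using (Real.hasDerivAt_tan (x := b * 0) (by simp)).comp 0 hmul
  obtain ⟨k, hk, hk0, hkm⟩ := exists_continuousAt_factor h1 (by simp)
  obtain ⟨j, hj, hj0, hjm⟩ := exists_continuousAt_factor h2 (by simp)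
  let φ : ℝ → ℝ := fun y => 2 * (k (Real.sqrt (2 * y)) + j (Real.sqrt (-(2 * y))) - b)
  have hφ0 : φ 0 = 2 * b := by simp [φ, hk0, hj0]
  have hφ : ContinuousAt φ 0 := by
    have c1 : ContinuousAt (fun y : ℝ => k (Real.sqrt (2 * y))) 0 :=
      ContinuousAt.comp (f := fun y : ℝ => Real.sqrt (2 * y)) (by simpa using hk) (by fun_prop)
    have c2 : ContinuousAt (fun y : ℝ => j (Real.sqrt (-(2 * y)))) 0 :=
      ContinuousAt.comp (f := fun y : ℝ => Real.sqrt (-(2 * y))) (by simpa using hj) (by fun_prop)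
    exact ((c1.add c2).sub continuousAt_const).const_mul 2
  have key : ∀ y, alphaStar b y = y * φ y := by
    intro y
    rcases le_or_gt 0 y with hy | hy
    · have hz : Real.sqrt (-(2 * y)) = 0 := Real.sqrt_eq_zero_of_nonpos (by linarith)
      have hs := Real.mul_self_sqrt (show 0 ≤ 2 * y by linarith)
      simp only [alphaStar, if_pos hy, hkm, φ, hz, hj0]
      linear_combination k (Real.sqrt (2 * y)) * hs
    · have hz : Real.sqrt (2 * y) = 0 := Real.sqrt_eq_zero_of_nonpos (by linarith)
      have hs := Real.mul_self_sqrt (show 0 ≤ -(2 * y) by linarith)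
      simp only [alphaStar, if_neg (not_le.2 hy), hjm, φ, hz, hk0]
      linear_combination -j (Real.sqrt (-(2 * y))) * hs
  rw [hasDerivAt_iff_tendsto_slope, ← hφ0]
  refine (hφ.tendsto.mono_left nhdsWithin_le_nhds).congr' ?_
  filter_upwards [self_mem_nhdsWithin] with y hy
  have hy : y ≠ 0 := hy
  rw [slope_def_field, key, key, zero_mul, sub_zero, sub_zero, mul_div_cancel_left₀ _ hy]

theorem alphaStar_hasDerivAt {b x : ℝ} (hb : 0 < b) (hx : -(π ^ 2 / (8 * b ^ 2)) < x) :
    ∃ d, 0 < d ∧ HasDerivAt (alphaStar b) d x := by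
  rcases lt_trichotomy x 0 with h | rfl | h
  · exact alphaStar_hasDerivAt_of_neg hb h hx
  · exact ⟨2 * b, by positivity, alphaStar_hasDerivAt_zero b⟩
  · exact alphaStar_hasDerivAt_of_pos hb h

theorem strictMonoOn_alphaStar {b : ℝ} (hb : 0 < b) :
    StrictMonoOn (alphaStar b) (Set.Ioi (-(π ^ 2 / (8 * b ^ 2)))) := by
  refine strictMonoOn_of_deriv_pos (convex_Ioi _) (fun x hx => ?_) (fun x hx => ?_)
  · obtain ⟨d, -, hd⟩ := alphaStar_hasDerivAt hb hx
    exact hd.continuousAt.continuousWithinAt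
  · rw [interior_Ioi] at hx
    obtain ⟨d, hd0, hd⟩ := alphaStar_hasDerivAt hb hx
    rwa [hd.deriv]

theorem continuous_of_rightInverse_strictMonoOn {f V : ℝ → ℝ} {c : ℝ}
    (hf : StrictMonoOn f (Set.Ioi c)) (hV : ∀ α, V α ∈ Set.Ioi c ∧ f (V α) = α) :
    Continuous V := by
  have hmono : Monotone V := fun α β h =>
    (hf.le_iff_le (hV α).1 (hV β).1).1 (by rwa [(hV α).2, (hV β).2])
  refine continuous_iff_continuousAt.2 fun α => ?_
  refine continuousAt_of_monotoneOn_of_image_mem_nhds (hmono.monotoneOn Set.univ)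
    Filter.univ_mem (Filter.mem_of_superset (isOpen_Ioi.mem_nhds (hV α).1) fun x hx => ?_)
  exact ⟨f x, Set.mem_univ _, hf.injOn (hV _).1 hx (hV _).2⟩

theorem continuousWithinAt_zero_of_isLUB {V Vstar : ℝ → ℝ}
    (hVstar : ∀ x ∈ Set.Ici (0 : ℝ),
      IsLUB (Set.range fun α : ℝ => α * x - V α) (Vstar x)) :
    ContinuousWithinAt Vstar (Set.Ici 0) 0 := by
  have h0 := hVstar 0 (by simp)
  have h1 := hVstar 1 (by simp)
  refine tendsto_order.2 ⟨fun a ha => ?_, fun a ha => ?_⟩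
  · obtain ⟨_, ⟨α, rfl⟩, hα⟩ := (lt_isLUB_iff h0).1 ha
    have hc : ContinuousAt (fun y : ℝ => α * y - V α) 0 := by fun_prop
    filter_upwards [nhdsWithin_le_nhds (hc.eventually (lt_mem_nhds hα)), self_mem_nhdsWithin]
      with y hy hy0
    exact hy.trans_le ((hVstar y hy0).1 ⟨α, rfl⟩)
  · have hc : ContinuousAt (fun y : ℝ => (1 - y) * Vstar 0 + y * Vstar 1) 0 := by fun_prop
    have hlt : (1 - (0 : ℝ)) * Vstar 0 + 0 * Vstar 1 < a := by simpa using ha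
    filter_upwards [nhdsWithin_le_nhds (hc.eventually (gt_mem_nhds hlt)), self_mem_nhdsWithin,
      nhdsWithin_le_nhds (gt_mem_nhds (zero_lt_one (α := ℝ)))] with y hy hy0 hy1
    have hy0 : 0 ≤ y := hy0
    refine lt_of_le_of_lt ((hVstar y hy0).2 ?_) hy
    rintro _ ⟨α, rfl⟩
    have e0 : α * 0 - V α ≤ Vstar 0 := h0.1 ⟨α, rfl⟩
    have e1 : α * 1 - V α ≤ Vstar 1 := h1.1 ⟨α, rfl⟩
    have := mul_le_mul_of_nonneg_left e0 (sub_nonneg.2 hy1.le)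
    have := mul_le_mul_of_nonneg_left e1 hy0
    dsimp only
    linarith

/-- If the supremum is finite for all nonnegative slopes, it is attained at each positive one. -/
theorem exists_forall_le_of_isLUB {V Vstar : ℝ → ℝ} (hV : Continuous V)
    (hVstar : ∀ x ∈ Set.Ici (0 : ℝ),
      IsLUB (Set.range fun α : ℝ => α * x - V α) (Vstar x)) {x : ℝ} (hx : 0 < x) :
    ∃ α, ∀ β, β * x - V β ≤ α * x - V α := by
  refine Continuous.exists_forall_ge (f := fun α => α * x - V α) (by fun_prop) ?_
  have bound : ∀ y, 0 ≤ y → ∀ α, α * x - V α ≤ Vstar y + α * (x - y) := by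
    intro y hy α
    have : α * y - V α ≤ Vstar y := (hVstar y hy).1 ⟨α, rfl⟩
    linarith
  rw [cocompact_eq_atBot_atTop, Filter.tendsto_sup]
  constructor
  · refine Filter.tendsto_atBot_mono (bound (x / 2) (by positivity)) ?_
    exact Filter.tendsto_atBot_add_const_left _ _
      (Filter.tendsto_id.atBot_mul_const (by linarith))
  · refine Filter.tendsto_atBot_mono (bound (x + 1) (by positivity)) ?_
    exact Filter.tendsto_atBot_add_const_left _ _
      (Filter.tendsto_id.atTop_mul_const_of_neg (by linarith))

/-- A function on `(0, ∞)` admitting a continuous selection of subgradients is differentiable,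
with that selection as derivative. -/
theorem hasDerivAt_of_continuousAt_subgradient {F a : ℝ → ℝ} {x : ℝ} (hx : 0 < x)
    (hF : ∀ y z, 0 < y → 0 < z → a y * (z - y) ≤ F z - F y) (ha : ContinuousAt a x) :
    HasDerivAt F (a x) x := by
  rw [hasDerivAt_iff_tendsto_slope, tendsto_iff_norm_sub_tendsto_zero]
  have hlim : Filter.Tendsto (fun y => ‖a y - a x‖) (nhdsWithin x {x}ᶜ) (nhds 0) :=
    (tendsto_iff_norm_sub_tendsto_zero.1 ha.tendsto).mono_left nhdsWithin_le_nhds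
  refine squeeze_zero' (Filter.Eventually.of_forall fun _ => norm_nonneg _) ?_ hlim
  filter_upwards [self_mem_nhdsWithin, nhdsWithin_le_nhds (lt_mem_nhds hx)] with y hy hy0
  have hy : y - x ≠ 0 := sub_ne_zero.2 hy
  have e1 := hF x y hx hy0
  have e2 := hF y x hy0 hx
  have hsl : slope F x y - a x = (F y - F x - a x * (y - x)) / (y - x) := by
    rw [slope_def_field]
    field_simp
  rw [hsl, norm_div, div_le_iff₀ (norm_pos_iff.2 hy), ← norm_mul, Real.norm_eq_abs,
    Real.norm_eq_abs, abs_of_nonneg (by linarith)]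
  exact le_trans (by linarith) (le_abs_self _)

/-- For `b > 0`, `V = (α*)⁻¹` and `V*(x) = sup_α (α x - V(α))` for `x ≥ 0`,
the function `V*` is continuous on `[0, ∞)`, continuously differentiable on
`(0, ∞)`, and `(V*)'(x) = α*(λ*(x))` for `x > 0`, where `λ*(x)` is the unique
solution in `(-π²/(8b²), ∞)` of `(α*)'(λ) = 1/x`. -/
theorem legendre_transform_of_V_regularity_and_deriv (b : ℝ) (hb : 0 < b)
    (V : ℝ → ℝ)
    (hV : ∀ α : ℝ, V α ∈ Set.Ioi (-(π ^ 2 / (8 * b ^ 2))) ∧ alphaStar b (V α) = α)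
    (Vstar : ℝ → ℝ)
    (hVstar : ∀ x ∈ Set.Ici (0 : ℝ),
      IsLUB (Set.range fun α : ℝ => α * x - V α) (Vstar x))
    (lamStar : ℝ → ℝ)
    (hlamStar : ∀ x : ℝ, 0 < x →
      lamStar x ∈ Set.Ioi (-(π ^ 2 / (8 * b ^ 2))) ∧
      deriv (alphaStar b) (lamStar x) = 1 / x ∧
      (∀ lam ∈ Set.Ioi (-(π ^ 2 / (8 * b ^ 2))), deriv (alphaStar b) lam = 1 / x →
        lam = lamStar x)) :
    ContinuousOn Vstar (Set.Ici 0) ∧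
    ContDiffOn ℝ 1 Vstar (Set.Ioi 0) ∧
    ∀ x : ℝ, 0 < x → deriv Vstar x = alphaStar b (lamStar x) := by
  have hderiv : ∀ α, ∃ d, 0 < d ∧ HasDerivAt (alphaStar b) d (V α) := fun α =>
    alphaStar_hasDerivAt hb (hV α).1
  have hVc : Continuous V := continuous_of_rightInverse_strictMonoOn (strictMonoOn_alphaStar hb) hV
  have hVd : ∀ α, HasDerivAt V (deriv (alphaStar b) (V α))⁻¹ α := by
    intro α
    obtain ⟨d, hd0, hd⟩ := hderiv α
    rw [hd.deriv]
    exact hd.of_local_left_inverse hVc.continuousAt hd0.ne'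
      (Filter.Eventually.of_forall fun β => (hV β).2)
  set a : ℝ → ℝ := fun x => alphaStar b (lamStar x) with ha
  have hmax : ∀ x, 0 < x → ∀ β, β * x - V β ≤ a x * x - V (a x) := by
    intro x hx
    obtain ⟨α, hα⟩ := exists_forall_le_of_isLUB hVc hVstar hx
    have hcrit : 1 * x - (deriv (alphaStar b) (V α))⁻¹ = 0 :=
      IsLocalMax.hasDerivAt_eq_zero (f := fun β => β * x - V β)
        (Filter.Eventually.of_forall hα) (((hasDerivAt_id α).mul_const x).sub (hVd α))
    have hlam : V α = lamStar x := by
      refine (hlamStar x hx).2.2 _ (hV α).1 ?_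
      rw [one_div, ← inv_inv (deriv (alphaStar b) (V α))]
      congr 1
      linarith
    have : a x = α := by simp only [ha, ← hlam, (hV α).2]
    rwa [this]
  have hval : ∀ x, 0 < x → Vstar x = a x * x - V (a x) := by
    intro x hx
    refine (hVstar x hx.le).unique ⟨?_, fun u hu => hu ⟨a x, rfl⟩⟩
    rintro _ ⟨β, rfl⟩
    exact hmax x hx β
  have hsub : ∀ y z, 0 < y → 0 < z → a y * (z - y) ≤ Vstar z - Vstar y := by
    intro y z hy hz
    rw [hval y hy, hval z hz]
    linarith [hmax z hz (a y)]
  have hmono : MonotoneOn a (Set.Ioi 0) := by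
    intro y hy z hz hyz
    rcases hyz.eq_or_lt with rfl | hlt
    · exact le_rfl
    · have e1 := hsub y z hy hz
      have e2 := hsub z y hz hy
      refine le_of_mul_le_mul_right ?_ (sub_pos.2 hlt)
      linarith
  have hsurj : a '' Set.Ioi 0 = Set.univ := by
    refine Set.eq_univ_of_forall fun α => ?_
    obtain ⟨d, hd0, hd⟩ := hderiv α
    refine ⟨1 / d, one_div_pos.2 hd0, ?_⟩
    have hlam := (hlamStar (1 / d) (one_div_pos.2 hd0)).2.2 _ (hV α).1
      (by rw [hd.deriv, one_div_one_div])
    simp only [ha, ← hlam, (hV α).2]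
  have hac : ∀ x, 0 < x → ContinuousAt a x := fun x hx =>
    continuousAt_of_monotoneOn_of_image_mem_nhds hmono (isOpen_Ioi.mem_nhds hx)
      (by rw [hsurj]; exact Filter.univ_mem)
  have hD : ∀ x, 0 < x → HasDerivAt Vstar (a x) x := fun x hx =>
    hasDerivAt_of_continuousAt_subgradient hx hsub (hac x hx)
  refine ⟨fun x hx => ?_, ?_, fun x hx => (hD x hx).deriv⟩
  · rcases (Set.mem_Ici.1 hx).eq_or_lt with rfl | h
    · exact continuousWithinAt_zero_of_isLUB hVstar
    · exact (hD x h).continuousAt.continuousWithinAt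
  · rw [show (1 : WithTop ℕ∞) = 0 + 1 from rfl, contDiffOn_succ_iff_deriv_of_isOpen isOpen_Ioi]
    refine ⟨fun x hx => (hD x hx).differentiableAt.differentiableWithinAt, by simp, ?_⟩
    rw [contDiffOn_zero]
    exact ContinuousOn.congr (fun x hx => (hac x hx).continuousWithinAt)
      fun x hx => (hD x hx).deriv
end
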